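/- Let 𝒞 be a simply connected twin chamber system over a set I, and let G be a gallery in Opp(𝒞). Then G is homotopic in Opp(𝒞) to a gallery H = (c₀, …, c_k) such that for each μ ∈ {1, …, k} there exists ε ∈ {+,−} with the property that the 𝒞_ε-components of c_{μ−1} and c_μ are equal. -/

import Mathlib

/-! ## Chamber systems, galleries, homotopy, and twin chamber systems -/

namespace TwinChamber

universe u v

variable {I : Type u} {C : Type v}

/-- Two chambers are `i`-adjacent for some `i ∈ J`. -/
def JAdj (adj : I → C → C → Prop) (J : Set I) (c d : C) : Prop := ∃ j ∈ J, adj j c d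

/-- Two chambers are adjacent if they are `i`-adjacent for some `i ∈ I`. -/
def Adj (adj : I → C → C → Prop) (c d : C) : Prop := ∃ i, adj i c d

/-- A gallery is a nonempty finite sequence of chambers in which consecutive chambers are
adjacent. -/
def IsGallery (adj : I → C → C → Prop) (l : List C) : Prop :=
  l ≠ [] ∧ l.Chain' (Adj adj)

/-- `d` lies in the `J`-residue of `c`: there is a `J`-gallery from `c` to `d`. -/
def InResidue (adj : I → C → C → Prop) (J : Set I) (c d : C) : Prop :=
  Relation.ReflTransGen (JAdj adj J) c d

/-- Two galleries are elementary homotopic if they coincide on an initial segment and a final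
segment, and the two intermediate subgalleries are `J`-galleries, with the same first and last
chambers, for some `J ⊆ I` with `|J| ≤ 2`. -/
def ElemHomotopic (adj : I → C → C → Prop) (G H : List C) : Prop :=
  ∃ (P M M' S : List C) (J : Set I),
    J.Finite ∧ J.ncard ≤ 2 ∧
    M ≠ [] ∧ M' ≠ [] ∧
    M.head? = M'.head? ∧ M.getLast? = M'.getLast? ∧
    M.Chain' (JAdj adj J) ∧ M'.Chain' (JAdj adj J) ∧
    G = P ++ M ++ S ∧ H = P ++ M' ++ S

/-- Two galleries are homotopic if they are connected by a finite chain of elementary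
homotopies. -/
def Homotopic (adj : I → C → C → Prop) : List C → List C → Prop :=
  Relation.ReflTransGen (ElemHomotopic adj)

/-- A closed gallery is null-homotopic if it is homotopic to the length-zero gallery at its
initial chamber. -/
def NullHomotopic (adj : I → C → C → Prop) (G : List C) : Prop :=
  ∃ c, G.head? = some c ∧ Homotopic adj G [c]

/-- A chamber system is connected if any two chambers are joined by a gallery. -/
def Connected (adj : I → C → C → Prop) : Prop :=
  ∀ c d : C, Relation.ReflTransGen (Adj adj) c d

/-- A chamber system is simply connected if it is connected and every closed gallery is
null-homotopic. -/
def SimplyConnected (adj : I → C → C → Prop) : Prop :=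
  Connected adj ∧
    ∀ G : List C, IsGallery adj G → G.head? = G.getLast? → NullHomotopic adj G

/-- The reduced gallery of a gallery: delete every chamber equal to its immediate
predecessor. -/
noncomputable def reduced (l : List C) : List C :=
  letI : DecidableEq C := Classical.decEq C
  l.destutter (· ≠ ·)

/-- A twin chamber system over `I`: a pair of chamber systems `(Cp, adjp)`, `(Cm, adjm)` over
`I` (each `adj i` an equivalence relation) together with a symmetric opposition relation `op`
between them, satisfying the axioms (TCS1)–(TCS4) for both signs. -/
structure TwinCS (I : Type u) : Type (max u (v + 1)) where
  /-- The positive chamber set. -/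
  Cp : Type v
  /-- The negative chamber set. -/
  Cm : Type v
  /-- `i`-adjacency on `Cp`. -/
  adjp : I → Cp → Cp → Prop
  /-- `i`-adjacency on `Cm`. -/
  adjm : I → Cm → Cm → Prop
  eqvp : ∀ i, Equivalence (adjp i)
  eqvm : ∀ i, Equivalence (adjm i)
  /-- The opposition relation between `Cp` and `Cm`. -/
  op : Cp → Cm → Prop
  tcs1p : ∀ (i j : I) (c d : Cp) (x y : Cm), adjp i c d → adjm j x y →
    op d x → op c x → op c y → op d y ∨ j = i
  tcs1m : ∀ (i j : I) (c d : Cm) (x y : Cp), adjm i c d → adjp j x y →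
    op x d → op x c → op y c → op y d ∨ j = i
  tcs2p : ∀ (i : I) (c d : Cp) (x : Cm), adjp i c d → op c x →
    ∃ y : Cm, adjm i x y ∧ op c y ∧ op d y
  tcs2m : ∀ (i : I) (c d : Cm) (x : Cp), adjm i c d → op x c →
    ∃ y : Cp, adjp i x y ∧ op y c ∧ op y d
  tcs3p : ∀ (c : Cp) (x y : Cm), op c x → op c y →
    Relation.ReflTransGen (fun u v => op c u ∧ op c v ∧ Adj adjm u v) x y
  tcs3pJ : ∀ (c : Cp) (J : Set I), J.Finite → J.ncard ≤ 2 → ∀ x y : Cm, op c x → op c y →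
    InResidue adjm J x y →
    Relation.ReflTransGen (fun u v => op c u ∧ op c v ∧ JAdj adjm J u v) x y
  tcs3m : ∀ (c : Cm) (x y : Cp), op x c → op y c →
    Relation.ReflTransGen (fun u v => op u c ∧ op v c ∧ Adj adjp u v) x y
  tcs3mJ : ∀ (c : Cm) (J : Set I), J.Finite → J.ncard ≤ 2 → ∀ x y : Cp, op x c → op y c →
    InResidue adjp J x y →
    Relation.ReflTransGen (fun u v => op u c ∧ op v c ∧ JAdj adjp J u v) x y
  tcs4p : ∀ c : Cp, ∃ ω : Cm → Cp,
    (∀ (i : I) (x y : Cm), adjm i x y → adjp i (ω x) (ω y)) ∧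
    (∀ x, op (ω x) x) ∧ (∀ x, op c x → ω x = c)
  tcs4m : ∀ c : Cm, ∃ ω : Cp → Cm,
    (∀ (i : I) (x y : Cp), adjp i x y → adjm i (ω x) (ω y)) ∧
    (∀ x, op x (ω x)) ∧ (∀ x, op x c → ω x = c)

/-- The chambers of `Opp(𝒞)`: pairs of opposite chambers. -/
def OppC (T : TwinCS.{u, v} I) : Type v := {p : T.Cp × T.Cm // T.op p.1 p.2}

/-- `i`-adjacency on `Opp(𝒞)`: componentwise `i`-adjacency. -/
def oppAdj (T : TwinCS.{u, v} I) : I → OppC T → OppC T → Prop :=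
  fun i u v => T.adjp i u.1.1 v.1.1 ∧ T.adjm i u.1.2 v.1.2

/-- A twin chamber system is simply connected if both of its halves are simply connected
chamber systems. -/
def TwinSC (T : TwinCS.{u, v} I) : Prop :=
  SimplyConnected T.adjp ∧ SimplyConnected T.adjm


/-- Homotopies may be prolonged by a common initial chamber. -/
theorem Homotopic.cons {adj : I → C → C → Prop} {G H : List C} (h : Homotopic adj G H) (a : C) :
    Homotopic adj (a :: G) (a :: H) := by
  refine Relation.ReflTransGen.lift (List.cons a) ?_ _ _ h
  rintro _ _ ⟨P, M, M', S, J, hJ, hc, hM, hM', hh, hl, hg, hg', rfl, rfl⟩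
  exact ⟨a :: P, M, M', S, J, hJ, hc, hM, hM', hh, hl, hg, hg', rfl, rfl⟩

/-- Any two `i`-adjacent chambers of `Opp(𝒞)` are joined by an `i`-gallery of length three that
changes only one component at a time. -/
theorem exists_stuttering_path (T : TwinCS.{u, v} I) {i : I} {a b : OppC T}
    (h : oppAdj T i a b) :
    ∃ m n : OppC T, oppAdj T i a m ∧ oppAdj T i m n ∧ oppAdj T i n b ∧
      a.1.1 = m.1.1 ∧ m.1.2 = n.1.2 ∧ n.1.1 = b.1.1 := by
  obtain ⟨hp, hm⟩ := h
  obtain ⟨z, hz, haz, hbz⟩ := T.tcs2p i _ _ _ hp a.2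
  exact ⟨⟨(a.1.1, z), haz⟩, ⟨(b.1.1, z), hbz⟩, ⟨(T.eqvp i).refl _, hz⟩,
    ⟨hp, (T.eqvm i).refl _⟩, ⟨(T.eqvp i).refl _, (T.eqvm i).trans ((T.eqvm i).symm hz) hm⟩,
    rfl, rfl, rfl⟩

/-- A nonempty gallery of `Opp(𝒞)` is homotopic to a stuttering one with the same first
chamber. -/
theorem exists_homotopic_stuttering_cons (T : TwinCS.{u, v} I) (L : List (OppC T)) (a : OppC T)
    (hL : (a :: L).IsChain (Adj (oppAdj T))) :
    ∃ H : List (OppC T), (a :: H).IsChain (Adj (oppAdj T)) ∧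
      Homotopic (oppAdj T) (a :: L) (a :: H) ∧
      (a :: H).IsChain (fun u v => u.1.1 = v.1.1 ∨ u.1.2 = v.1.2) := by
  induction L generalizing a with
  | nil => exact ⟨[], hL, .refl, by simp⟩
  | cons b L ih =>
    rw [List.isChain_cons_cons] at hL
    obtain ⟨⟨i, hi⟩, hL⟩ := hL
    obtain ⟨H, hH, hLH, hs⟩ := ih b hL
    obtain ⟨m, n, ham, hmn, hnb, h₁, h₂, h₃⟩ := exists_stuttering_path T hi
    refine ⟨m :: n :: b :: H, ?_, (hLH.cons a).tail ?_, ?_⟩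
    · simp only [List.isChain_cons_cons]
      exact ⟨⟨i, ham⟩, ⟨i, hmn⟩, ⟨i, hnb⟩, hH⟩
    · exact ⟨[], [a, b], [a, m, n, b], H, {i}, Set.finite_singleton i, by simp, by simp, by simp,
        rfl, rfl, by simpa [List.Chain', JAdj] using hi,
        by simpa [List.Chain', JAdj] using ⟨ham, hmn, hnb⟩, rfl, rfl⟩
    · simp only [List.isChain_cons_cons]
      exact ⟨.inl h₁, .inr h₂, .inl h₃, hs⟩

/-- Let `𝒞` be a simply connected twin chamber system and `G` a gallery in
`Opp(𝒞)`. Then `G` is homotopic in `Opp(𝒞)` to a gallery `H` in which each pair of consecutive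
chambers agrees in the `𝒞₊`-component or in the `𝒞₋`-component. -/
theorem homotopic_to_stuttering_gallery {I : Type u} (T : TwinCS.{u, v} I)
    (hT : TwinSC T) (G : List (OppC T)) (hG : IsGallery (oppAdj T) G) :
    ∃ H : List (OppC T), IsGallery (oppAdj T) H ∧ Homotopic (oppAdj T) G H ∧
      H.Chain' (fun u v => u.1.1 = v.1.1 ∨ u.1.2 = v.1.2) := by
  obtain ⟨hne, hc⟩ := hG
  obtain ⟨a, L, rfl⟩ := List.exists_cons_of_ne_nil hne
  obtain ⟨H, hH, hLH, hs⟩ := exists_homotopic_stuttering_cons T L a hc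
  exact ⟨a :: H, ⟨List.cons_ne_nil a H, hH⟩, hLH, hs⟩

end TwinChamber
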